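/- Let m ≥ 3 be an integer, ρ = (m-1)/2, and let l ∈ ℕ with l > ρ. Let s ∈ ℂ with -ρ < Re(s) < l - ρ, let a ∈ ℝ with a ≠ 0, and let b ∈ ℝ. Then ∫_{-1}^{1} (1-t²)^{l-ρ-1} · ₁F₁(l-ρ-s, l; 2πi(at+b)) dt = (√π · Γ(l) Γ(l-ρ)) / (Γ(s+ρ) Γ(l-ρ-s)) · (π|a|)^{-l+ρ+1/2} · I_l^{(s)}(|a|, b), where I_l^{(s)}(A, b) = ∫₀^1 (1-x)^{s+ρ-1} x^{-(s+1/2)} J_{l-ρ-1/2}(2πAx) exp(2πibx) dx for A > 0, and both integrals converge absolutely. -/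

import Mathlib

open MeasureTheory

/-- The Bessel function of the first kind `J_ν`, defined by its power series. -/
noncomputable def besselJ (ν : ℝ) (x : ℝ) : ℝ :=
  ∑' k : ℕ, (-1) ^ k / (k.factorial * Real.Gamma (ν + k + 1)) * (x / 2) ^ (ν + 2 * (k : ℝ))

/-- Kummer's confluent hypergeometric function `₁F₁(a, c; x)`, defined by its power series
`Σ_{n} (a)_n / ((c)_n n!) xⁿ`. -/
noncomputable def kummer1F1 (a c x : ℂ) : ℂ :=
  ∑' n : ℕ, (∏ k ∈ Finset.range n, (a + k)) /
    ((∏ k ∈ Finset.range n, (c + k)) * (n.factorial : ℂ)) * x ^ n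

/-- The integral `I_l^{(s)}(A, b) = ∫₀¹ (1-x)^{s+ρ-1} x^{-(s+1/2)} J_{l-ρ-1/2}(2πAx) e^{2πibx} dx`. -/
noncomputable def Iint (ρ : ℝ) (l : ℕ) (s : ℂ) (A b : ℝ) : ℂ :=
  ∫ x in (0 : ℝ)..1,
    ((1 - x : ℝ) : ℂ) ^ (s + (ρ : ℂ) - 1) * ((x : ℝ) : ℂ) ^ (-(s + 1 / 2)) *
      (besselJ ((l : ℝ) - ρ - 1 / 2) (2 * Real.pi * A * x) : ℂ) *
      Complex.exp (2 * Real.pi * Complex.I * b * x)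


lemma aux_hasSum_moment (μ : Measure ℝ) (w : ℝ → ℂ) (hw : Integrable w μ)
    (hb : ∀ᵐ t ∂μ, |t| ≤ 1) (z : ℂ) :
    HasSum (fun n : ℕ => z ^ n / (n.factorial : ℂ) * ∫ t, w t * (t : ℂ) ^ n ∂μ)
      (∫ t, w t * Complex.exp (z * t) ∂μ) := by
  have hbn : ∀ n : ℕ, ∀ᵐ (t : ℝ) ∂μ, ‖((t : ℂ)) ^ n‖ ≤ 1 := by
    intro n
    filter_upwards [hb] with t ht
    rw [norm_pow, Complex.norm_real, Real.norm_eq_abs]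
    exact pow_le_one₀ (abs_nonneg _) ht
  have hint : ∀ n : ℕ, Integrable (fun t : ℝ => w t * (t : ℂ) ^ n) μ := by
    intro n
    exact hw.mul_bdd (c := 1) (by fun_prop) (hbn n)
  have key := hasSum_integral_of_summable_integral_norm (μ := μ)
    (F := fun (n : ℕ) (t : ℝ) => z ^ n / (n.factorial : ℂ) * (w t * (t : ℂ) ^ n))
    (fun n => (hint n).const_mul _) ?_
  · have e1 : (fun n : ℕ => z ^ n / (n.factorial : ℂ) * ∫ t, w t * (t : ℂ) ^ n ∂μ) =
        fun n : ℕ => ∫ t, z ^ n / (n.factorial : ℂ) * (w t * (t : ℂ) ^ n) ∂μ := by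
      funext n
      rw [integral_const_mul]
    have e2 : ∫ t, w t * Complex.exp (z * t) ∂μ =
        ∫ t, ∑' n : ℕ, z ^ n / (n.factorial : ℂ) * (w t * (t : ℂ) ^ n) ∂μ := by
      refine integral_congr_ae (Filter.Eventually.of_forall fun t => ?_)
      have h := (NormedSpace.expSeries_div_hasSum_exp (𝔸 := ℂ) (z * t)).mul_left (w t)
      rw [← Complex.exp_eq_exp_ℂ] at h
      simp only
      rw [← h.tsum_eq]
      congr 1
      ext n
      rw [mul_pow]; ring
    rw [e1, e2]
    exact key
  · refine Summable.of_nonneg_of_le (fun n => integral_nonneg fun t => norm_nonneg _) (fun n => ?_)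
      ((Real.summable_pow_div_factorial ‖z‖).mul_right (∫ t, ‖w t‖ ∂μ))
    rw [← integral_const_mul]
    refine integral_mono_ae ((hint n).const_mul _).norm (hw.norm.const_mul _) ?_
    filter_upwards [hbn n] with t ht
    rw [norm_mul, norm_mul, norm_div, norm_pow, Complex.norm_natCast]
    gcongr
    exact mul_le_of_le_one_right (norm_nonneg _) ht

lemma aux_Gamma_poch (α : ℂ) (hα : 0 < α.re) (n : ℕ) :
    Complex.Gamma (α + n) = (∏ k ∈ Finset.range n, (α + k)) * Complex.Gamma α := by
  induction n with
  | zero => simp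
  | succ n ih =>
    rw [Finset.prod_range_succ]
    push_cast
    rw [← add_assoc, Complex.Gamma_add_one, ih]
    · ring
    · intro h
      have := congrArg Complex.re h
      simp at this
      have hn : (0 : ℝ) ≤ n := Nat.cast_nonneg n
      linarith

/-- weight for Kummer -/
noncomputable def auxV (α β : ℂ) (x : ℝ) : ℂ := (x : ℂ) ^ (α - 1) * (1 - (x : ℂ)) ^ (β - 1)

lemma auxV_integrable (α β : ℂ) (hα : 0 < α.re) (hβ : 0 < β.re) :
    Integrable (auxV α β) (volume.restrict (Set.Ioc 0 1)) := by
  have := Complex.betaIntegral_convergent hα hβ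
  rw [intervalIntegrable_iff_integrableOn_Ioc_of_le zero_le_one] at this
  exact this

lemma auxV_moment (α β : ℂ) (n : ℕ) :
    ∫ x in Set.Ioc (0 : ℝ) 1, auxV α β x * (x : ℂ) ^ n = Complex.betaIntegral (α + n) β := by
  rw [Complex.betaIntegral, intervalIntegral.integral_of_le zero_le_one]
  refine setIntegral_congr_fun measurableSet_Ioc fun x hx => ?_
  have hx0 : (x : ℂ) ≠ 0 := by exact_mod_cast hx.1.ne'
  simp only [auxV]
  rw [show α + n - 1 = (α - 1) + n by ring, Complex.cpow_add _ _ hx0, Complex.cpow_natCast]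
  ring

lemma aux_kummer (α β z : ℂ) (hα : 0 < α.re) (hβ : 0 < β.re) :
    kummer1F1 α (α + β) z = Complex.Gamma (α + β) / (Complex.Gamma α * Complex.Gamma β) *
      ∫ x in Set.Ioc (0 : ℝ) 1, auxV α β x * Complex.exp (z * x) := by
  have hb : ∀ᵐ t ∂(volume.restrict (Set.Ioc (0 : ℝ) 1)), |t| ≤ 1 := by
    filter_upwards [ae_restrict_mem measurableSet_Ioc] with t ht
    rw [abs_of_pos ht.1]; exact ht.2
  have h := (aux_hasSum_moment _ _ (auxV_integrable α β hα hβ) hb z).mul_left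
    (Complex.Gamma (α + β) / (Complex.Gamma α * Complex.Gamma β))
  rw [kummer1F1, ← h.tsum_eq]
  congr 1
  ext n
  have hαβ : 0 < (α + β).re := by simp; linarith
  have hαn : 0 < (α + n).re := by
    simp; have hn : (0 : ℝ) ≤ n := Nat.cast_nonneg n
    linarith
  rw [auxV_moment, Complex.betaIntegral_eq_Gamma_mul_div _ _ hαn hβ,
    show α + n + β = α + β + n by ring, aux_Gamma_poch _ hα, aux_Gamma_poch _ hαβ]
  have h1 := Complex.Gamma_ne_zero_of_re_pos hα
  have h2 := Complex.Gamma_ne_zero_of_re_pos hβ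
  have h3 := Complex.Gamma_ne_zero_of_re_pos hαβ
  have h4 : (∏ k ∈ Finset.range n, (α + β + k)) ≠ 0 := by
    refine Finset.prod_ne_zero_iff.2 fun k _ h => ?_
    have := congrArg Complex.re h
    simp at this hαβ
    have hn : (0 : ℝ) ≤ k := Nat.cast_nonneg k
    linarith
  have h5 : (n.factorial : ℂ) ≠ 0 := by exact_mod_cast n.factorial_ne_zero
  field_simp

/-- Gegenbauer weight -/
noncomputable def auxW (σ : ℝ) (t : ℝ) : ℂ := (((1 - t ^ 2) ^ (σ - 1) : ℝ) : ℂ)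

lemma auxW_neg (σ t : ℝ) : auxW σ (-t) = auxW σ t := by simp [auxW]

lemma auxW_int01 (σ : ℝ) (hσ : 0 < σ) : IntervalIntegrable (auxW σ) volume 0 1 := by
  have h1 : IntervalIntegrable (fun x : ℝ => (1 - x) ^ (σ - 1)) volume 0 1 := by
    have := (intervalIntegral.intervalIntegrable_rpow' (a := 0) (b := 1) (r := σ - 1)
      (by linarith)).comp_sub_left 1
    simpa using this.symm
  have h2 : ContinuousOn (fun x : ℝ => (1 + x) ^ (σ - 1)) (Set.uIcc 0 1) := by
    refine ContinuousOn.rpow_const (by fun_prop) fun x hx => ?_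
    rw [Set.uIcc_of_le zero_le_one] at hx
    left; linarith [hx.1]
  have h3 : IntervalIntegrable (fun x : ℝ => (((1 - x) ^ (σ - 1) * (1 + x) ^ (σ - 1) : ℝ) : ℂ))
      volume 0 1 := by
    have h4 := h1.mul_continuousOn h2
    rw [intervalIntegrable_iff] at h4 ⊢
    exact Integrable.ofReal h4
  refine h3.congr fun x hx => ?_
  rw [Set.uIoc_of_le zero_le_one] at hx
  simp only [auxW]
  rw [← Real.mul_rpow (by linarith [hx.2]) (by linarith [hx.1])]
  congr 2; ring

lemma auxW_int (σ : ℝ) (hσ : 0 < σ) : IntervalIntegrable (auxW σ) volume (-1) 1 := by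
  have h := auxW_int01 σ hσ
  have h' := ((IntervalIntegrable.iff_comp_neg (by finiteness)).1 h).symm
  simp only [auxW_neg, neg_zero] at h'
  exact h'.trans h

lemma auxW_moment_odd (σ : ℝ) (k : ℕ) :
    ∫ t in (-1 : ℝ)..1, auxW σ t * (t : ℂ) ^ (2 * k + 1) = 0 := by
  have h := intervalIntegral.integral_comp_neg (a := -1) (b := 1)
    (fun t : ℝ => auxW σ t * (t : ℂ) ^ (2 * k + 1))
  have hodd : Odd (2 * k + 1) := ⟨k, rfl⟩
  simp only [auxW_neg, Complex.ofReal_neg, hodd.neg_pow, mul_neg, neg_neg,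
    intervalIntegral.integral_neg] at h
  exact self_eq_neg.mp h.symm

lemma auxW_moment_half (σ : ℝ) (k : ℕ) :
    2 * ∫ t in (0 : ℝ)..1, auxW σ t * (t : ℂ) ^ (2 * k) =
      Complex.betaIntegral (k + 1 / 2) σ := by
  have h := integral_comp_rpow_Ioi_of_pos (p := 2) (g := (Set.Ioc (0 : ℝ) 1).indicator
    (fun x : ℝ => (x : ℂ) ^ ((k : ℂ) + 1 / 2 - 1) * (1 - (x : ℂ)) ^ ((σ : ℂ) - 1))) two_pos
  rw [setIntegral_indicator measurableSet_Ioc,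
    Set.inter_eq_right.2 Set.Ioc_subset_Ioi_self] at h
  rw [Complex.betaIntegral, intervalIntegral.integral_of_le zero_le_one,
    intervalIntegral.integral_of_le zero_le_one, ← h, ← integral_const_mul]
  have hI : ∀ f : ℝ → ℂ, ∫ t in Set.Ioc (0 : ℝ) 1, f t =
      ∫ t in Set.Ioi (0 : ℝ), (Set.Ioc (0 : ℝ) 1).indicator f t := by
    intro f
    rw [setIntegral_indicator measurableSet_Ioc, Set.inter_eq_right.2 Set.Ioc_subset_Ioi_self]
  rw [hI]
  refine setIntegral_congr_fun measurableSet_Ioi fun t ht => ?_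
  simp only [Set.mem_Ioi] at ht
  have hmem : t ^ (2 : ℝ) ∈ Set.Ioc (0 : ℝ) 1 ↔ t ∈ Set.Ioc (0 : ℝ) 1 := by
    simp only [Set.mem_Ioc, Real.rpow_two]
    constructor
    · rintro ⟨_, h2⟩
      exact ⟨ht, by nlinarith⟩
    · rintro ⟨_, h2⟩
      exact ⟨by positivity, by nlinarith⟩
  by_cases hm : t ∈ Set.Ioc (0 : ℝ) 1
  · rw [Set.indicator_of_mem hm, Set.indicator_of_mem (hmem.2 hm)]
    have h0 : (t : ℂ) ≠ 0 := by exact_mod_cast ht.ne'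
    have e1 : ((t ^ (2 : ℝ) : ℝ) : ℂ) ^ ((k : ℂ) + 1 / 2 - 1) * t = (t : ℂ) ^ (2 * k) := by
      rw [Real.rpow_two, pow_two, Complex.ofReal_mul,
        Complex.mul_cpow_ofReal_nonneg ht.le ht.le, ← Complex.cpow_add _ _ h0]
      nth_rewrite 2 [← Complex.cpow_one (t : ℂ)]
      rw [← Complex.cpow_add _ _ h0, ← Complex.cpow_natCast]
      congr 1
      push_cast
      ring
    have e2 : (1 - ((t ^ (2 : ℝ) : ℝ) : ℂ)) ^ ((σ : ℂ) - 1) = auxW σ t := by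
      rw [Real.rpow_two, auxW, Complex.ofReal_cpow (by nlinarith [hm.1, hm.2])]
      push_cast
      rfl
    rw [← e1, ← e2]
    simp only [Complex.real_smul]
    norm_num
    ring
  · rw [Set.indicator_of_notMem hm, Set.indicator_of_notMem (fun h => hm (hmem.1 h)), smul_zero]

lemma auxW_moment_even (σ : ℝ) (hσ : 0 < σ) (k : ℕ) :
    ∫ t in (-1 : ℝ)..1, auxW σ t * (t : ℂ) ^ (2 * k) = 
      Complex.betaIntegral (k + 1 / 2) σ := by
  rw [← auxW_moment_half]
  have h0 : IntervalIntegrable (fun t : ℝ => auxW σ t * (t : ℂ) ^ (2 * k)) volume 0 1 :=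
    (auxW_int01 σ hσ).mul_continuousOn (by fun_prop)
  have h := intervalIntegral.integral_comp_neg (a := 0) (b := 1)
    (fun t : ℝ => auxW σ t * (t : ℂ) ^ (2 * k))
  have heven : Even (2 * k) := even_two_mul k
  have h' := ((IntervalIntegrable.iff_comp_neg (by finiteness)).1 h0).symm
  simp only [auxW_neg, Complex.ofReal_neg, heven.neg_pow, neg_zero] at h h'
  rw [← intervalIntegral.integral_add_adjacent_intervals h' h0, ← h]
  ring

lemma aux_Gamma_half (k : ℕ) : Real.Gamma (k + 1 / 2) =
    (2 * k).factorial * √Real.pi / (4 ^ k * k.factorial) := by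
  induction k with
  | zero => simp [-one_div, Real.Gamma_one_half_eq]
  | succ k ih =>
    rw [show ((k + 1 : ℕ) : ℝ) + 1 / 2 = (k + 1 / 2) + 1 by push_cast; ring,
      Real.Gamma_add_one (by positivity), ih, show 2 * (k + 1) = 2 * k + 1 + 1 by ring,
      Nat.factorial_succ, Nat.factorial_succ, Nat.factorial_succ]
    push_cast
    have : (k.factorial : ℝ) ≠ 0 := by positivity
    field_simp
    ring

lemma aux_ae_abs_le : ∀ᵐ t ∂(volume.restrict (Set.Ioc (-1 : ℝ) 1)), |t| ≤ 1 := by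
  filter_upwards [ae_restrict_mem measurableSet_Ioc] with t ht
  exact abs_le.2 ⟨ht.1.le, ht.2⟩

lemma auxW_integrable (σ : ℝ) (hσ : 0 < σ) :
    Integrable (auxW σ) (volume.restrict (Set.Ioc (-1) 1)) :=
  (intervalIntegrable_iff_integrableOn_Ioc_of_le (by norm_num)).1 (auxW_int σ hσ)

lemma aux_poisson_term (σ : ℝ) (hσ : 0 < σ) (y : ℝ) (hy : y ≠ 0) (k : ℕ) :
    (Complex.I * y) ^ (2 * k) / ((2 * k).factorial : ℂ) * Complex.betaIntegral (k + 1 / 2) σ =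
      ((√Real.pi * Real.Gamma σ * (|y| / 2) ^ (-(σ - 1 / 2)) *
        ((-1) ^ k / (k.factorial * Real.Gamma (σ - 1 / 2 + k + 1)) *
          (|y| / 2) ^ (σ - 1 / 2 + 2 * (k : ℝ))) : ℝ) : ℂ) := by
  have hk : (0 : ℝ) ≤ k := Nat.cast_nonneg k
  have hy2 : 0 < |y| / 2 := by have := abs_pos.2 hy; positivity
  rw [Complex.betaIntegral_eq_Gamma_mul_div _ _ (by simp; positivity) (by simpa using hσ)]
  rw [show ((k : ℂ) + 1 / 2) = ((k + 1 / 2 : ℝ) : ℂ) by push_cast; ring, ← Complex.ofReal_add,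
    Complex.Gamma_ofReal, Complex.Gamma_ofReal, Complex.Gamma_ofReal, aux_Gamma_half,
    pow_mul, mul_pow, Complex.I_sq]
  have e : √Real.pi * Real.Gamma σ * (|y| / 2) ^ (-(σ - 1 / 2)) *
        ((-1) ^ k / (k.factorial * Real.Gamma (σ - 1 / 2 + k + 1)) *
          (|y| / 2) ^ (σ - 1 / 2 + 2 * (k : ℝ))) =
      (-1 * y ^ 2) ^ k / ((2 * k).factorial) * ((2 * k).factorial * √Real.pi / (4 ^ k * k.factorial)
       * Real.Gamma σ / Real.Gamma (k + 1 / 2 + σ)) := by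
    have e1 : (|y| / 2) ^ (-(σ - 1 / 2)) * (|y| / 2) ^ (σ - 1 / 2 + 2 * (k : ℝ)) =
        (y ^ 2) ^ k / 4 ^ k := by
      rw [← Real.rpow_add hy2, show -(σ - 1 / 2) + (σ - 1 / 2 + 2 * (k : ℝ)) = ((2 * k : ℕ) : ℝ) by
        push_cast; ring, Real.rpow_natCast, pow_mul, div_pow, sq_abs, div_pow]
      norm_num
    rw [show σ - 1 / 2 + k + 1 = k + 1 / 2 + σ by ring, mul_pow]
    have hG : Real.Gamma (k + 1 / 2 + σ) ≠ 0 := (Real.Gamma_pos_of_pos (by positivity)).ne'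
    have hf : ((2 * k).factorial : ℝ) ≠ 0 := by positivity
    have hf' : (k.factorial : ℝ) ≠ 0 := by positivity
    calc _ = √Real.pi * Real.Gamma σ * ((-1) ^ k / (k.factorial * Real.Gamma (k + 1 / 2 + σ))) *
          ((|y| / 2) ^ (-(σ - 1 / 2)) * (|y| / 2) ^ (σ - 1 / 2 + 2 * (k : ℝ))) := by ring
      _ = _ := by rw [e1]; field_simp
  rw [e]
  push_cast
  ring

lemma aux_poisson (σ : ℝ) (hσ : 0 < σ) (y : ℝ) (hy : y ≠ 0) :
    ∫ t in Set.Ioc (-1 : ℝ) 1, auxW σ t * Complex.exp (Complex.I * y * t) =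
      ((√Real.pi * Real.Gamma σ * (|y| / 2) ^ (-(σ - 1 / 2)) * besselJ (σ - 1 / 2) |y| : ℝ) : ℂ) := by
  have h := aux_hasSum_moment _ _ (auxW_integrable σ hσ) aux_ae_abs_le (Complex.I * y)
  rw [← h.tsum_eq]
  have hinj : Function.Injective (fun k : ℕ => 2 * k) := fun i j h => by simpa using h
  rw [← hinj.tsum_eq]
  · rw [besselJ, ← tsum_mul_left, Complex.ofReal_tsum]
    congr 1
    funext k
    rw [← intervalIntegral.integral_of_le (by norm_num), auxW_moment_even σ hσ,
      aux_poisson_term σ hσ y hy]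
  · intro n hn
    by_contra hc
    rcases Nat.even_or_odd' n with ⟨k, rfl | rfl⟩
    · exact hc ⟨k, rfl⟩
    · apply hn
      simp only
      rw [← intervalIntegral.integral_of_le (by norm_num), auxW_moment_odd, mul_zero]

lemma aux_prod_integrable (σ : ℝ) (hσ : 0 < σ) (α β : ℂ) (hα : 0 < α.re) (hβ : 0 < β.re)
    (a b : ℝ) :
    Integrable (Function.uncurry fun (t x : ℝ) => auxW σ t * (auxV α β x *
      Complex.exp (2 * Real.pi * Complex.I * ((a * t + b : ℝ) : ℂ) * x)))
      ((volume.restrict (Set.Ioc (-1 : ℝ) 1)).prod (volume.restrict (Set.Ioc (0 : ℝ) 1))) := by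
  have h := (auxW_integrable σ hσ).mul_prod (auxV_integrable α β hα hβ)
  have h2 := h.mul_bdd (c := 1) (g := fun p : ℝ × ℝ =>
    Complex.exp (2 * Real.pi * Complex.I * ((a * p.1 + b : ℝ) : ℂ) * p.2))
    (Continuous.aestronglyMeasurable (by fun_prop)) (Filter.Eventually.of_forall fun p => by
      rw [show 2 * Real.pi * Complex.I * ((a * p.1 + b : ℝ) : ℂ) * p.2 =
        ((2 * Real.pi * (a * p.1 + b) * p.2 : ℝ) : ℂ) * Complex.I by push_cast; ring,
        Complex.norm_exp_ofReal_mul_I])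
  refine h2.congr (Filter.Eventually.of_forall fun p => ?_)
  simp only [Function.uncurry]
  ring

/-- the inner integral over `t` -/
lemma aux_inner (σ : ℝ) (hσ : 0 < σ) (α β : ℂ) (a : ℝ) (ha : a ≠ 0) (b x : ℝ) (hx : 0 < x) :
    ∫ t in Set.Ioc (-1 : ℝ) 1, auxW σ t * (auxV α β x *
      Complex.exp (2 * Real.pi * Complex.I * ((a * t + b : ℝ) : ℂ) * x)) =
    ((√Real.pi * Real.Gamma σ * (Real.pi * |a|) ^ (-σ + 1 / 2) : ℝ) : ℂ) *
      (((1 - x : ℝ) : ℂ) ^ (β - 1) * (x : ℂ) ^ (-((σ - α) + 1 / 2)) *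
      (besselJ (σ - 1 / 2) (2 * Real.pi * |a| * x) : ℂ) *
      Complex.exp (2 * Real.pi * Complex.I * b * x)) := by
  have hp := aux_poisson σ hσ (2 * Real.pi * a * x)
    (mul_ne_zero (mul_ne_zero (by positivity) ha) hx.ne')
  have hab : |2 * Real.pi * a * x| = 2 * Real.pi * |a| * x := by
    rw [abs_mul, abs_mul, abs_of_pos hx, abs_of_pos Real.two_pi_pos]
  rw [hab] at hp
  have hx0 : (x : ℂ) ≠ 0 := by exact_mod_cast hx.ne'
  have hapos := abs_pos.2 ha
  have hpow : (2 * Real.pi * |a| * x / 2) ^ (-(σ - 1 / 2)) =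
      (Real.pi * |a|) ^ (-σ + 1 / 2) * x ^ (-σ + 1 / 2) := by
    rw [← Real.mul_rpow (by positivity) hx.le]
    congr 1 <;> ring
  rw [hpow] at hp
  have hxx : (x : ℂ) ^ (-((σ - α) + 1 / 2)) = (x : ℂ) ^ (α - 1) * ((x ^ (-σ + 1 / 2) : ℝ) : ℂ) := by
    rw [Complex.ofReal_cpow hx.le, ← Complex.cpow_add _ _ hx0]
    congr 1
    push_cast
    ring
  calc _ = ∫ t in Set.Ioc (-1 : ℝ) 1, auxV α β x * Complex.exp (2 * Real.pi * Complex.I * b * x) *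
        (auxW σ t * Complex.exp (Complex.I * ((2 * Real.pi * a * x : ℝ) : ℂ) * t)) := by
        refine integral_congr_ae (Filter.Eventually.of_forall fun t => ?_)
        simp only
        rw [show 2 * Real.pi * Complex.I * ((a * t + b : ℝ) : ℂ) * x =
          2 * Real.pi * Complex.I * b * x + Complex.I * ((2 * Real.pi * a * x : ℝ) : ℂ) * t by
            push_cast; ring, Complex.exp_add]
        ring
    _ = _ := by
        rw [integral_const_mul, hp, hxx, auxV]
        push_cast
        ring

theorem aux_main (ρ : ℝ) (l : ℕ) (hl : ρ < l) (s : ℂ) (hs1 : -ρ < s.re) (hs2 : s.re < (l : ℝ) - ρ)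
    (a : ℝ) (ha : a ≠ 0) (b : ℝ) :
    IntervalIntegrable (fun t : ℝ =>
        (((1 - t ^ 2) ^ ((l : ℝ) - ρ - 1) : ℝ) : ℂ) *
          kummer1F1 ((l : ℂ) - ρ - s) (l : ℂ)
            (2 * Real.pi * Complex.I * ((a * t + b : ℝ) : ℂ)))
      MeasureTheory.volume (-1) 1 ∧
    IntervalIntegrable (fun x : ℝ =>
        ((1 - x : ℝ) : ℂ) ^ (s + (ρ : ℂ) - 1) *
          ((x : ℝ) : ℂ) ^ (-(s + 1 / 2)) *
          (besselJ ((l : ℝ) - ρ - 1 / 2) (2 * Real.pi * |a| * x) : ℂ) *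
          Complex.exp (2 * Real.pi * Complex.I * b * x))
      MeasureTheory.volume 0 1 ∧
    (∫ t in (-1 : ℝ)..1,
        (((1 - t ^ 2) ^ ((l : ℝ) - ρ - 1) : ℝ) : ℂ) *
          kummer1F1 ((l : ℂ) - ρ - s) (l : ℂ)
            (2 * Real.pi * Complex.I * ((a * t + b : ℝ) : ℂ)))
      = ((Real.sqrt Real.pi : ℝ) : ℂ) * Complex.Gamma (l : ℂ) *
          Complex.Gamma ((l : ℂ) - ρ) /
          (Complex.Gamma (s + ρ) *
            Complex.Gamma ((l : ℂ) - ρ - s)) *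
          (((Real.pi * |a|) ^ (-(l : ℝ) + ρ + 1 / 2) : ℝ) : ℂ) *
          Iint ρ l s |a| b := by
  have hσ : 0 < (l : ℝ) - ρ := by linarith
  have hα : 0 < ((l : ℂ) - ρ - s).re := by simp; linarith
  have hβ : 0 < (s + (ρ : ℂ)).re := by simp; linarith
  have hsum : (l : ℂ) - ρ - s + (s + (ρ : ℂ)) = l := by ring
  set σ : ℝ := (l : ℝ) - ρ with hσdef
  set α : ℂ := (l : ℂ) - ρ - s with hαdef
  set β : ℂ := s + (ρ : ℂ) with hβdef
  have hsα : s = (σ : ℂ) - α := by rw [hσdef, hαdef]; push_cast; ring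
  have hK : (fun t : ℝ => (((1 - t ^ 2) ^ (σ - 1) : ℝ) : ℂ) *
      kummer1F1 α (l : ℂ) (2 * Real.pi * Complex.I * ((a * t + b : ℝ) : ℂ))) =
      fun t : ℝ => Complex.Gamma (l : ℂ) / (Complex.Gamma α * Complex.Gamma β) *
        ∫ x in Set.Ioc (0 : ℝ) 1, auxW σ t * (auxV α β x *
          Complex.exp (2 * Real.pi * Complex.I * ((a * t + b : ℝ) : ℂ) * x)) := by
    funext t
    rw [integral_const_mul]
    nth_rewrite 1 [← hsum]
    rw [aux_kummer α β _ hα hβ, hsum, auxW]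
    ring
  have hF := aux_prod_integrable σ hσ α β hα hβ a b
  set c : ℝ := √Real.pi * Real.Gamma σ * (Real.pi * |a|) ^ (-σ + 1 / 2) with hc
  have hapos := abs_pos.2 ha
  have hc0 : (c : ℂ) ≠ 0 := by
    have h1 := Real.Gamma_pos_of_pos hσ
    have : 0 < c := by positivity
    exact_mod_cast this.ne'
  have hin : ∀ x ∈ Set.Ioc (0 : ℝ) 1, ∫ t in Set.Ioc (-1 : ℝ) 1, auxW σ t * (auxV α β x *
      Complex.exp (2 * Real.pi * Complex.I * ((a * t + b : ℝ) : ℂ) * x)) =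
      (c : ℂ) * (((1 - x : ℝ) : ℂ) ^ (β - 1) *
          ((x : ℝ) : ℂ) ^ (-(s + 1 / 2)) *
          (besselJ (σ - 1 / 2) (2 * Real.pi * |a| * x) : ℂ) *
          Complex.exp (2 * Real.pi * Complex.I * b * x)) := by
    intro x hx
    rw [aux_inner σ hσ α β a ha b x hx.1, ← hsα]
  refine ⟨?_, ?_, ?_⟩
  · rw [hK, intervalIntegrable_iff_integrableOn_Ioc_of_le (by norm_num)]
    exact hF.integral_prod_left.const_mul _
  · rw [intervalIntegrable_iff_integrableOn_Ioc_of_le (by norm_num)]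
    have h := hF.integral_prod_right.const_mul (c : ℂ)⁻¹
    refine h.congr ?_
    filter_upwards [ae_restrict_mem measurableSet_Ioc] with x hx
    have := hin x hx
    simp only [Function.uncurry]
    rw [this, inv_mul_cancel_left₀ hc0]
  · rw [hK, intervalIntegral.integral_of_le (by norm_num), integral_const_mul,
      integral_integral_swap hF, setIntegral_congr_fun measurableSet_Ioc hin, integral_const_mul,
      Iint, intervalIntegral.integral_of_le (by norm_num)]
    rw [show (l : ℂ) - ρ = ((σ : ℝ) : ℂ) by rw [hσdef]; push_cast; ring, Complex.Gamma_ofReal,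
      hc, show -(l : ℝ) + ρ + 1 / 2 = -σ + 1 / 2 by rw [hσdef]; ring]
    push_cast
    ring

/-- For `ρ = (m-1)/2`, `l > ρ`, `-ρ < Re s < l - ρ`, `a ≠ 0`:
`∫_{-1}^1 (1-t²)^{l-ρ-1} ₁F₁(l-ρ-s, l; 2πi(at+b)) dt
  = √π Γ(l)Γ(l-ρ)/(Γ(s+ρ)Γ(l-ρ-s)) (π|a|)^{-l+ρ+1/2} I_l^{(s)}(|a|, b)`,
both integrals being absolutely convergent. -/
theorem stmt18 (m : ℕ) (hm : 3 ≤ m) (l : ℕ) (hl : ((m : ℝ) - 1) / 2 < l)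
    (s : ℂ) (hs1 : -(((m : ℝ) - 1) / 2) < s.re) (hs2 : s.re < (l : ℝ) - ((m : ℝ) - 1) / 2)
    (a : ℝ) (ha : a ≠ 0) (b : ℝ) :
    IntervalIntegrable (fun t : ℝ =>
        (((1 - t ^ 2) ^ ((l : ℝ) - ((m : ℝ) - 1) / 2 - 1) : ℝ) : ℂ) *
          kummer1F1 ((l : ℂ) - ((m : ℂ) - 1) / 2 - s) (l : ℂ)
            (2 * Real.pi * Complex.I * ((a * t + b : ℝ) : ℂ)))
      MeasureTheory.volume (-1) 1 ∧
    IntervalIntegrable (fun x : ℝ =>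
        ((1 - x : ℝ) : ℂ) ^ (s + (((m : ℝ) - 1) / 2 : ℝ) - 1) *
          ((x : ℝ) : ℂ) ^ (-(s + 1 / 2)) *
          (besselJ ((l : ℝ) - ((m : ℝ) - 1) / 2 - 1 / 2) (2 * Real.pi * |a| * x) : ℂ) *
          Complex.exp (2 * Real.pi * Complex.I * b * x))
      MeasureTheory.volume 0 1 ∧
    (∫ t in (-1 : ℝ)..1,
        (((1 - t ^ 2) ^ ((l : ℝ) - ((m : ℝ) - 1) / 2 - 1) : ℝ) : ℂ) *
          kummer1F1 ((l : ℂ) - ((m : ℂ) - 1) / 2 - s) (l : ℂ)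
            (2 * Real.pi * Complex.I * ((a * t + b : ℝ) : ℂ)))
      = ((Real.sqrt Real.pi : ℝ) : ℂ) * Complex.Gamma (l : ℂ) *
          Complex.Gamma ((l : ℂ) - ((m : ℂ) - 1) / 2) /
          (Complex.Gamma (s + ((m : ℂ) - 1) / 2) *
            Complex.Gamma ((l : ℂ) - ((m : ℂ) - 1) / 2 - s)) *
          (((Real.pi * |a|) ^ (-(l : ℝ) + ((m : ℝ) - 1) / 2 + 1 / 2) : ℝ) : ℂ) *
          Iint (((m : ℝ) - 1) / 2) l s |a| b := by
  have h := aux_main (((m : ℝ) - 1) / 2) l hl s hs1 hs2 a ha b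
  have e : ((((m : ℝ) - 1) / 2 : ℝ) : ℂ) = ((m : ℂ) - 1) / 2 := by push_cast; ring
  rw [← e]
  exact h
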